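/- arXiv:2211.06602 — 2 statements merged into one kernel-verified Lean document; each statement's English description precedes it below -/
import Mathlib

section
/- The Lebesgue integral over ℝ of the complex-valued function x ↦ (1 − 3x²)/((x−i)⁵(x+i)³) equals −3π/16. -/
open Real Complex MeasureTheory

theorem ofReal_sub_I_ne_zero (x : ℝ) : (x : ℂ) - I ≠ 0 := fun h => by
  simpa using congrArg Complex.im h

theorem ofReal_add_I_ne_zero (x : ℝ) : (x : ℂ) + I ≠ 0 := fun h => by
  simpa using congrArg Complex.im h

theorem norm_ofReal_sub_I (x : ℝ) : ‖(x : ℂ) - I‖ = √(1 + x ^ 2) := by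
  rw [Complex.norm_def]
  congr 1
  simp [Complex.normSq_apply]
  ring

theorem norm_ofReal_add_I (x : ℝ) : ‖(x : ℂ) + I‖ = √(1 + x ^ 2) := by
  rw [Complex.norm_def]
  congr 1
  simp [Complex.normSq_apply]
  ring

theorem integrable_phi3_integrand :
    Integrable fun x : ℝ =>
      (1 - 3 * (x : ℂ) ^ 2) / (((x : ℂ) - I) ^ 5 * ((x : ℂ) + I) ^ 3) := by
  refine (integrable_inv_one_add_sq.const_mul 3).mono' ?_ (.of_forall fun x => ?_)
  · refine Continuous.aestronglyMeasurable (Continuous.div (by fun_prop) (by fun_prop) fun x => ?_)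
    exact mul_ne_zero (pow_ne_zero _ (ofReal_sub_I_ne_zero x))
      (pow_ne_zero _ (ofReal_add_I_ne_zero x))
  · have hnum : ‖(1 - 3 * (x : ℂ) ^ 2)‖ ≤ 3 * (1 + x ^ 2) := by
      have h : (1 - 3 * (x : ℂ) ^ 2) = ((1 - 3 * x ^ 2 : ℝ) : ℂ) := by push_cast; rfl
      rw [h, Complex.norm_real, Real.norm_eq_abs, abs_le]
      constructor <;> nlinarith [sq_nonneg x]
    have hden : √(1 + x ^ 2) ^ 5 * √(1 + x ^ 2) ^ 3 = (1 + x ^ 2) ^ 4 := by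
      rw [← pow_add, show 5 + 3 = 2 * 4 from rfl, pow_mul, Real.sq_sqrt (by positivity)]
    rw [norm_div, norm_mul, norm_pow, norm_pow, norm_ofReal_sub_I, norm_ofReal_add_I, hden,
      div_le_iff₀ (by positivity)]
    have h1 : 1 ≤ (1 + x ^ 2) ^ 2 := one_le_pow₀ (by nlinarith [sq_nonneg x])
    have h2 : 3 * (1 + x ^ 2)⁻¹ * (1 + x ^ 2) ^ 4 = 3 * (1 + x ^ 2) * (1 + x ^ 2) ^ 2 := by
      field_simp
    rw [h2]
    exact hnum.trans (le_mul_of_one_le_right (by positivity) h1)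

/-- The rational part of the antiderivative of the integrand, in the variables
`u = (x - i)⁻¹` and `v = (x + i)⁻¹`. -/
noncomputable def phi3RationalPart (u v : ℂ) : ℂ :=
  -(I / 8) * u ^ 4 - 1 / 16 * u - I / 16 * v ^ 2 - 1 / 8 * v

theorem hasDerivAt_phi3_antiderivative (x : ℝ) :
    HasDerivAt (fun x : ℝ => -(3 / 16) * (Real.arctan x : ℂ) +
        phi3RationalPart ((x : ℂ) - I)⁻¹ ((x : ℂ) + I)⁻¹)
      ((1 - 3 * (x : ℂ) ^ 2) / (((x : ℂ) - I) ^ 5 * ((x : ℂ) + I) ^ 3)) x := by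
  have hx : HasDerivAt (fun x : ℝ => (x : ℂ)) 1 x := Complex.ofRealCLM.hasDerivAt
  have hu := (hx.sub_const I).fun_inv (ofReal_sub_I_ne_zero x)
  have hv := (hx.add_const I).fun_inv (ofReal_add_I_ne_zero x)
  have ha := (Real.hasDerivAt_arctan' x).ofReal_comp
  have h := (ha.const_mul (-(3 / 16) : ℂ)).add
    (((((hu.fun_pow 4).const_mul (-(I / 8))).sub (hu.const_mul (1 / 16))).sub
      ((hv.fun_pow 2).const_mul (I / 16))).sub (hv.const_mul (1 / 8)))
  refine h.congr_deriv ?_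
  have hs : (((1 + x ^ 2)⁻¹ : ℝ) : ℂ) = ((x : ℂ) - I)⁻¹ * ((x : ℂ) + I)⁻¹ := by
    push_cast
    rw [← mul_inv]
    congr 1
    linear_combination I_sq
  rw [hs]
  norm_num only [Nat.cast_ofNat, pow_one]
  have h1 := ofReal_sub_I_ne_zero x
  have h2 := ofReal_add_I_ne_zero x
  field_simp
  ring_nf
  simp only [show I ^ 3 = -I from I_pow_three, show I ^ 4 = 1 from I_pow_four, I_sq,
    show I ^ 5 = I by rw [pow_succ, I_pow_four, one_mul],
    show I ^ 6 = -1 by rw [show 6 = 4 + 2 from rfl, pow_add, I_pow_four, I_sq, one_mul]]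
  ring

theorem tendsto_phi3_antiderivative {l : Filter ℝ} {a : ℝ}
    (hl : Filter.Tendsto (fun x : ℝ => (x : ℂ)) l (Bornology.cobounded ℂ))
    (ha : Filter.Tendsto Real.arctan l (nhds a)) :
    Filter.Tendsto (fun x : ℝ => -(3 / 16) * (Real.arctan x : ℂ) +
        phi3RationalPart ((x : ℂ) - I)⁻¹ ((x : ℂ) + I)⁻¹) l (nhds (-(3 / 16) * (a : ℂ))) := by
  have hu : Filter.Tendsto (fun x : ℝ => ((x : ℂ) - I)⁻¹) l (nhds 0) :=
    Filter.tendsto_inv₀_cobounded.comp ((tendsto_sub_const_cobounded I).comp hl)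
  have hv : Filter.Tendsto (fun x : ℝ => ((x : ℂ) + I)⁻¹) l (nhds 0) :=
    Filter.tendsto_inv₀_cobounded.comp ((tendsto_add_const_cobounded I).comp hl)
  have h := (((Complex.continuous_ofReal.tendsto a).comp ha).const_mul (-(3 / 16) : ℂ)).add
    (((((hu.pow 4).const_mul (-(I / 8))).sub (hu.const_mul (1 / 16))).sub
      ((hv.pow 2).const_mul (I / 16))).sub (hv.const_mul (1 / 8)))
  simpa [phi3RationalPart] using h

theorem integral_phi3_b :
    ∫ x : ℝ, ((1 - 3 * (x : ℂ) ^ 2)) / (((x : ℂ) - I) ^ 5 * ((x : ℂ) + I) ^ 3) = -(3 * (π : ℂ) / 16) := by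
  have hnorm {l : Filter ℝ} (h : Filter.Tendsto (fun x : ℝ => |x|) l Filter.atTop) :
      Filter.Tendsto (fun x : ℝ => (x : ℂ)) l (Bornology.cobounded ℂ) := by
    rw [← tendsto_norm_atTop_iff_cobounded]
    simpa using h
  rw [integral_of_hasDerivAt_of_tendsto hasDerivAt_phi3_antiderivative integrable_phi3_integrand
    (tendsto_phi3_antiderivative (hnorm Filter.tendsto_abs_atBot_atTop)
      (tendsto_nhds_of_tendsto_nhdsWithin tendsto_arctan_atBot))
    (tendsto_phi3_antiderivative (hnorm Filter.tendsto_abs_atTop_atTop)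
      (tendsto_nhds_of_tendsto_nhdsWithin tendsto_arctan_atTop))]
  push_cast
  ring
end

section
/- The Lebesgue integral over ℝ of the complex-valued function x ↦ x(3x² − 1)/((x−i)⁵(x+i)³) equals πi/16. -/
open Real Complex MeasureTheory

open Filter Topology

theorem ofReal_add_ne_zero_of_im_ne_zero {c : ℂ} (hc : c.im ≠ 0) (x : ℝ) : (x : ℂ) + c ≠ 0 := by
  intro h
  apply hc
  simpa using congrArg Complex.im h

theorem tendsto_inv_ofReal_add_atTop (c : ℂ) :
    Tendsto (fun x : ℝ => ((x : ℂ) + c)⁻¹) atTop (𝓝 0) :=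
  tendsto_inv₀_cobounded.comp <|
    (tendsto_add_const_cobounded c).comp (RCLike.tendsto_ofReal_atTop_cobounded ℂ)

theorem tendsto_inv_ofReal_add_atBot (c : ℂ) :
    Tendsto (fun x : ℝ => ((x : ℂ) + c)⁻¹) atBot (𝓝 0) :=
  tendsto_inv₀_cobounded.comp <|
    (tendsto_add_const_cobounded c).comp (RCLike.tendsto_ofReal_atBot_cobounded ℂ)

theorem hasDerivAt_inv_ofReal_add {c : ℂ} (hc : c.im ≠ 0) (x : ℝ) :
    HasDerivAt (fun x : ℝ => ((x : ℂ) + c)⁻¹) (-1 / ((x : ℂ) + c) ^ 2) x :=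
  ((hasDerivAt_id x).ofReal_comp.add_const c).fun_inv (ofReal_add_ne_zero_of_im_ne_zero hc x)

/-- An antiderivative of `x (3 x² - 1) / ((x - i)⁵ (x + i)³)` on the real line. -/
noncomputable def phi5Antideriv (x : ℝ) : ℂ :=
  -(1 / 8) * ((x : ℂ) + -I)⁻¹ ^ 4 + I / 6 * ((x : ℂ) + -I)⁻¹ ^ 3 + I / 16 * ((x : ℂ) + -I)⁻¹
    + 1 / 16 * ((x : ℂ) + I)⁻¹ ^ 2 + I / 16 * (Real.arctan x : ℂ)

theorem hasDerivAt_phi5Antideriv (x : ℝ) :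
    HasDerivAt phi5Antideriv
      (((x : ℂ) * (3 * (x : ℂ) ^ 2 - 1)) / (((x : ℂ) - I) ^ 5 * ((x : ℂ) + I) ^ 3)) x := by
  have h₁ := hasDerivAt_inv_ofReal_add (c := -I) (by simp) x
  have h₂ := hasDerivAt_inv_ofReal_add (c := I) (by simp) x
  have h₃ := (Real.hasDerivAt_arctan x).ofReal_comp
  have hd := (((((h₁.fun_pow 4).const_mul (-(1 / 8))).fun_add
    ((h₁.fun_pow 3).const_mul (I / 6))).fun_add (h₁.const_mul (I / 16))).fun_add
    ((h₂.fun_pow 2).const_mul (1 / 16))).fun_add (h₃.const_mul (I / 16))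
  refine hd.congr_deriv ?_
  have n₁ : (x : ℂ) - I ≠ 0 := by
    simpa [sub_eq_add_neg] using ofReal_add_ne_zero_of_im_ne_zero (c := -I) (by simp) x
  have n₂ : (x : ℂ) + I ≠ 0 := ofReal_add_ne_zero_of_im_ne_zero (by simp) x
  have hfac : (1 : ℂ) + (x : ℂ) ^ 2 = ((x : ℂ) - I) * ((x : ℂ) + I) := by
    linear_combination I_sq
  push_cast
  rw [hfac, ← sub_eq_add_neg]
  field_simp
  ring_nf
  have e3 : I ^ 3 = -I := I_pow_three
  have e4 : I ^ 4 = 1 := I_pow_four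
  have e5 : I ^ 5 = I := by rw [pow_succ, e4, one_mul]
  have e6 : I ^ 6 = -1 := by rw [pow_succ, e5, I_mul_I]
  have e7 : I ^ 7 = -I := by rw [pow_succ, e6, neg_one_mul]
  simp only [I_sq, e3, e4, e5, e6, e7]
  ring

theorem tendsto_phi5Antideriv {l : Filter ℝ} {a : ℝ}
    (h : ∀ c : ℂ, Tendsto (fun x : ℝ => ((x : ℂ) + c)⁻¹) l (𝓝 0))
    (ha : Tendsto Real.arctan l (𝓝 a)) :
    Tendsto phi5Antideriv l (𝓝 (I / 16 * (a : ℂ))) := by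
  have h₃ : Tendsto (fun x : ℝ => (Real.arctan x : ℂ)) l (𝓝 (a : ℂ)) :=
    (continuous_ofReal.tendsto a).comp ha
  have ht := ((((((h (-I)).pow 4).const_mul (-(1 / 8))).add
    (((h (-I)).pow 3).const_mul (I / 6))).add ((h (-I)).const_mul (I / 16))).add
    (((h I).pow 2).const_mul (1 / 16))).add (h₃.const_mul (I / 16))
  have hval : I / 16 * (a : ℂ) =
      -(1 / 8) * 0 ^ 4 + I / 6 * 0 ^ 3 + I / 16 * 0 + 1 / 16 * 0 ^ 2 + I / 16 * (a : ℂ) := by simp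
  rw [hval]
  exact ht

theorem norm_ofReal_add_I_sq (x : ℝ) : ‖(x : ℂ) + I‖ ^ 2 = 1 + x ^ 2 := by
  rw [Complex.sq_norm, normSq_apply]
  simp
  ring

theorem norm_ofReal_sub_I_sq (x : ℝ) : ‖(x : ℂ) - I‖ ^ 2 = 1 + x ^ 2 := by
  rw [Complex.sq_norm, normSq_apply]
  simp
  ring

theorem integrable_phi5_integrand : Integrable fun x : ℝ =>
    ((x : ℂ) * (3 * (x : ℂ) ^ 2 - 1)) / (((x : ℂ) - I) ^ 5 * ((x : ℂ) + I) ^ 3) := by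
  refine (integrable_inv_one_add_sq.const_mul 3).mono'
    (Measurable.aestronglyMeasurable (by fun_prop)) (ae_of_all _ fun x => ?_)
  have hp : ‖(x : ℂ) + I‖ = √(1 + x ^ 2) := by
    rw [← norm_ofReal_add_I_sq, Real.sqrt_sq (norm_nonneg _)]
  have hm : ‖(x : ℂ) - I‖ = √(1 + x ^ 2) := by
    rw [← norm_ofReal_sub_I_sq, Real.sqrt_sq (norm_nonneg _)]
  have hs : √(1 + x ^ 2) ^ 2 = 1 + x ^ 2 := Real.sq_sqrt (by positivity)
  have hden : √(1 + x ^ 2) ^ 5 * √(1 + x ^ 2) ^ 3 = (1 + x ^ 2) ^ 4 := by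
    rw [← pow_add, show 5 + 3 = 2 * 4 from rfl, pow_mul, hs]
  have hnum : ‖(x : ℂ) * (3 * (x : ℂ) ^ 2 - 1)‖ = |x * (3 * x ^ 2 - 1)| := by
    rw [← Real.norm_eq_abs, ← Complex.norm_real]; push_cast; rfl
  rw [norm_div, norm_mul (_ ^ 5), norm_pow, norm_pow, hp, hm, hden, hnum, ← div_eq_mul_inv,
    div_le_div_iff₀ (by positivity) (by positivity)]
  have hx : |x * (3 * x ^ 2 - 1)| ≤ 3 * (1 + x ^ 2) ^ 2 := by
    rw [abs_le]
    constructor <;> nlinarith [sq_nonneg (x ^ 2 - x), sq_nonneg (x ^ 2 + x), sq_nonneg (x - 1),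
      sq_nonneg (x + 1), sq_nonneg x, sq_nonneg (x ^ 2)]
  calc |x * (3 * x ^ 2 - 1)| * (1 + x ^ 2)
      ≤ 3 * (1 + x ^ 2) ^ 2 * (1 + x ^ 2) := by gcongr
    _ = 3 * (1 + x ^ 2) ^ 3 := by ring
    _ ≤ 3 * (1 + x ^ 2) ^ 4 := by
      gcongr
      · nlinarith [sq_nonneg x]
      · norm_num

theorem integral_phi5_a :
    ∫ x : ℝ, (((x : ℂ) * (3 * (x : ℂ) ^ 2 - 1))) / (((x : ℂ) - I) ^ 5 * ((x : ℂ) + I) ^ 3) = (π : ℂ) * I / 16 := by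
  rw [integral_of_hasDerivAt_of_tendsto hasDerivAt_phi5Antideriv integrable_phi5_integrand
    (tendsto_phi5Antideriv tendsto_inv_ofReal_add_atBot
      (tendsto_nhds_of_tendsto_nhdsWithin Real.tendsto_arctan_atBot))
    (tendsto_phi5Antideriv tendsto_inv_ofReal_add_atTop
      (tendsto_nhds_of_tendsto_nhdsWithin Real.tendsto_arctan_atTop))]
  push_cast
  ring
end
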